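/- arXiv:2007.15479 — 4 statements merged into one kernel-verified Lean document; each statement's English description precedes it below -/
import Mathlib

section
/- The Markov chain on I^k with transition matrix Q is irreducible and aperiodic. -/
open Finset

/-- The finite set of triples (father, mother, child) of pairwise distinct individuals. -/
def distinctTriplesFinset (N : ℕ) : Finset (Fin N × Fin N × Fin N) :=
  Finset.univ.filter fun p => p.1 ≠ p.2.1 ∧ p.1 ≠ p.2.2 ∧ p.2.1 ≠ p.2.2

/-- The factor `q_m(x, y, π, μ, κ)`: equals `1_{y_m = x_m}` if `x_m ≠ κ`, and
`(1/2)·1_{y_m = π} + (1/2)·1_{y_m = μ}` if `x_m = κ`. -/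
noncomputable def qFactor {N k : ℕ} (x y : Fin k → Fin N)
    (p : Fin N × Fin N × Fin N) (m : Fin k) : ℝ :=
  if x m = p.2.2 then
    (if y m = p.1 then 1 / 2 else 0) + (if y m = p.2.1 then 1 / 2 else 0)
  else if y m = x m then 1 else 0

/-- The transition matrix `Q` of the annealed `k`-particle Moran chain on `I^k`. -/
noncomputable def Qmat (N k : ℕ) : Matrix (Fin k → Fin N) (Fin k → Fin N) ℝ :=
  fun x y =>
    (1 / ((N : ℝ) * ((N : ℝ) - 1) * ((N : ℝ) - 2))) *
      ∑ p ∈ distinctTriplesFinset N, ∏ m : Fin k, qFactor x y p m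

/-- The configuration `{x}` of `x ∈ I^k`: the multiset of multiplicities with which the
distinct values of `I` appear among the coordinates of `x`. Its size (number of elements,
i.e. number of distinct values) is `(config x).card`. -/
def config {N k : ℕ} (x : Fin k → Fin N) : Multiset ℕ :=
  (Finset.image x Finset.univ).val.map fun v => (Finset.univ.filter fun m => x m = v).card


def MStep {N k : ℕ} (x y : Fin k → Fin N) : Prop :=
  ∃ a b c : Fin N, a ≠ b ∧ a ≠ c ∧ b ≠ c ∧
    ∀ m, (x m = c ∧ (y m = a ∨ y m = b)) ∨ (x m ≠ c ∧ y m = x m)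

lemma qFactor_nonneg' {N k : ℕ} (x y : Fin k → Fin N) (p : Fin N × Fin N × Fin N) (m : Fin k) :
    0 ≤ qFactor x y p m := by
  unfold qFactor
  split_ifs <;> norm_num

lemma const_pos' {N : ℕ} (hN : 3 ≤ N) :
    0 < (1 / ((N : ℝ) * ((N : ℝ) - 1) * ((N : ℝ) - 2))) := by
  have h : (3 : ℝ) ≤ N := by exact_mod_cast hN
  have h1 : 0 < (N : ℝ) := by linarith
  have h2 : 0 < (N : ℝ) - 1 := by linarith
  have h3 : 0 < (N : ℝ) - 2 := by linarith
  positivity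

lemma Qmat_nonneg' {N k : ℕ} (hN : 3 ≤ N) (x y : Fin k → Fin N) : 0 ≤ Qmat N k x y :=
  mul_nonneg (const_pos' hN).le
    (sum_nonneg fun p _ => prod_nonneg fun m _ => qFactor_nonneg' x y p m)

lemma MStep.pos {N k : ℕ} (hN : 3 ≤ N) {x y : Fin k → Fin N} (h : MStep x y) :
    0 < Qmat N k x y := by
  obtain ⟨a, b, c, hab, hac, hbc, h⟩ := h
  refine mul_pos (const_pos' hN) ?_
  refine sum_pos' (fun p _ => prod_nonneg fun m _ => qFactor_nonneg' x y p m)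
    ⟨(a, b, c), by simp [distinctTriplesFinset, hab, hac, hbc], ?_⟩
  refine prod_pos fun m _ => ?_
  unfold qFactor
  rcases h m with ⟨h1, h2 | h2⟩ | ⟨h1, h2⟩
  · simp [h1, h2, hab]
  · simp [h1, h2, hab.symm]
  · simp [h1, h2]

lemma pow_nonneg'' {N k : ℕ} (hN : 3 ≤ N) (n : ℕ) :
    ∀ x y : Fin k → Fin N, 0 ≤ (Qmat N k ^ n) x y := by
  induction n with
  | zero => intro x y; rw [pow_zero, Matrix.one_apply]; split_ifs <;> norm_num
  | succ n ih =>
    intro x y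
    rw [pow_succ, Matrix.mul_apply]
    exact sum_nonneg fun z _ => mul_nonneg (ih x z) (Qmat_nonneg' hN z y)

lemma pow_succ_pos' {N k : ℕ} (hN : 3 ≤ N) (n : ℕ) {x y z : Fin k → Fin N}
    (h1 : 0 < (Qmat N k ^ n) x y) (h2 : 0 < Qmat N k y z) : 0 < (Qmat N k ^ (n + 1)) x z := by
  rw [pow_succ, Matrix.mul_apply]
  exact sum_pos' (fun w _ => mul_nonneg (pow_nonneg'' hN n x w) (Qmat_nonneg' hN w z))
    ⟨y, mem_univ _, mul_pos h1 h2⟩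

lemma exists_hole {N k : ℕ} (hkN : k < N) (x : Fin k → Fin N) : ∃ c, ∀ m, x m ≠ c := by
  by_contra! h
  have := Fintype.card_le_of_surjective x h
  simp at this
  omega

lemma exists_third {N : ℕ} (hN : 3 ≤ N) (a b : Fin N) : ∃ c, c ≠ a ∧ c ≠ b := by
  by_contra! h
  have h1 : (univ : Finset (Fin N)) ⊆ {a, b} := by
    intro c _
    by_cases hc : c = a
    · simp [hc]
    · simp [h c hc]
  have h2 := card_le_card h1
  have h3 := card_le_two (a := a) (b := b)
  simp only [card_univ, Fintype.card_fin] at h2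
  omega

lemma MStep.self {N k : ℕ} (hkN : k < N) (hN : 3 ≤ N) (x : Fin k → Fin N) : MStep x x := by
  obtain ⟨c, hc⟩ := exists_hole hkN x
  obtain ⟨a, ha, -⟩ := exists_third hN c c
  obtain ⟨b, hb, hb'⟩ := exists_third hN c a
  exact ⟨a, b, c, hb'.symm, ha, hb, fun m => Or.inr ⟨hc m, rfl⟩⟩

lemma reach_const {N k : ℕ} (hk : 1 ≤ k) (hN : 3 ≤ N) (n : ℕ) :
    ∀ x : Fin k → Fin N, (univ.image x).card ≤ n →
      ∃ c : Fin N, Relation.ReflTransGen MStep x (fun _ => c) := by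
  induction n with
  | zero =>
    intro x hx
    have : x ⟨0, hk⟩ ∈ univ.image x := mem_image_of_mem _ (mem_univ _)
    have := card_pos.2 ⟨_, this⟩
    omega
  | succ n ih =>
    intro x hx
    by_cases h : ∃ i j, x i ≠ x j
    · obtain ⟨i, j, hij⟩ := h
      obtain ⟨b, hb, hb'⟩ := exists_third hN (x i) (x j)
      have hi : x i ∈ univ.image x := mem_image_of_mem _ (mem_univ _)
      obtain ⟨c, hc⟩ := ih (fun m => if x m = x i then x j else x m) (by
        have hs : univ.image (fun m => if x m = x i then x j else x m) ⊆
            (univ.image x).erase (x i) := by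
          intro v hv
          simp only [mem_image, mem_univ, true_and] at hv
          obtain ⟨m, rfl⟩ := hv
          split_ifs with hm
          · simp [hij.symm]
          · simp [hm]
        have := card_le_card hs
        rw [card_erase_of_mem hi] at this
        omega)
      refine ⟨c, Relation.ReflTransGen.head ⟨x j, b, x i, hb'.symm, hij.symm, hb, fun m => ?_⟩ hc⟩
      by_cases hm : x m = x i <;> simp [hm]
    · push Not at h
      refine ⟨x ⟨0, hk⟩, ?_⟩
      have : x = fun _ => x ⟨0, hk⟩ := funext fun m => h _ _
      rw [← this]

lemma const_reach {N k : ℕ} (hk : 1 ≤ k) (hkN : k < N) (n : ℕ) :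
    ∀ x : Fin k → Fin N, (univ.image x).card ≤ n →
      ∃ c : Fin N, Relation.ReflTransGen MStep (fun _ => c) x := by
  induction n with
  | zero =>
    intro x hx
    have : x ⟨0, hk⟩ ∈ univ.image x := mem_image_of_mem _ (mem_univ _)
    have := card_pos.2 ⟨_, this⟩
    omega
  | succ n ih =>
    intro x hx
    by_cases h : ∃ i j, x i ≠ x j
    · obtain ⟨i, j, hij⟩ := h
      obtain ⟨b, hb⟩ := exists_hole hkN x
      have hi : x i ∈ univ.image x := mem_image_of_mem _ (mem_univ _)
      have hj : x j ∈ (univ.image x).erase (x i) :=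
        mem_erase.2 ⟨hij.symm, mem_image_of_mem _ (mem_univ _)⟩
      obtain ⟨c, hc⟩ := ih (fun m => if x m = x i ∨ x m = x j then b else x m) (by
        have hs : univ.image (fun m => if x m = x i ∨ x m = x j then b else x m) ⊆
            insert b (((univ.image x).erase (x i)).erase (x j)) := by
          intro v hv
          simp only [mem_image, mem_univ, true_and] at hv
          obtain ⟨m, rfl⟩ := hv
          split_ifs with hm
          · simp
          · push Not at hm
            simp [hm]
        have h1 := card_le_card hs
        have h2 := card_insert_le b (((univ.image x).erase (x i)).erase (x j))
        have h3 := card_pos.2 ⟨_, hj⟩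
        rw [card_erase_of_mem hj] at h2
        rw [card_erase_of_mem hi] at h2 h3
        omega)
      refine ⟨c, Relation.ReflTransGen.tail hc ⟨x i, x j, b, hij, hb i, hb j, fun m => ?_⟩⟩
      by_cases hm : x m = x i ∨ x m = x j
      · simp [hm]
      · simp [hm, hb m]
    · push Not at h
      refine ⟨x ⟨0, hk⟩, ?_⟩
      have : x = fun _ => x ⟨0, hk⟩ := funext fun m => h _ _
      rw [← this]

lemma const_const {N k : ℕ} (hN : 3 ≤ N) (c d : Fin N) :
    Relation.ReflTransGen MStep (fun _ : Fin k => c) (fun _ => d) := by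
  by_cases h : c = d
  · rw [h]
  · obtain ⟨b, hb, hb'⟩ := exists_third hN c d
    exact Relation.ReflTransGen.single ⟨d, b, c, hb'.symm, Ne.symm h, hb, fun m => by simp⟩

/-- The annealed `k`-particle Moran chain on `I^k` is irreducible and aperiodic:
any state leads to any other in some positive number of steps, and for every state the
return probabilities are positive for all sufficiently large times. -/
theorem Qmat_irreducible_aperiodic (N k : ℕ) (hk : 1 ≤ k) (hkN : k < N) (hN : 3 ≤ N) :
    (∀ x y : Fin k → Fin N, ∃ n : ℕ, 0 < n ∧ 0 < (Qmat N k ^ n) x y) ∧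
    (∀ x : Fin k → Fin N, ∃ n₀ : ℕ, ∀ n : ℕ, n₀ ≤ n → 0 < (Qmat N k ^ n) x x) := by
  constructor
  · intro x y
    obtain ⟨c, hc⟩ := reach_const hk hN _ x le_rfl
    obtain ⟨d, hd⟩ := const_reach hk hkN _ y le_rfl
    have h := (hc.trans (const_const hN c d)).trans hd
    have key : ∃ n : ℕ, 0 < (Qmat N k ^ n) x y := by
      clear hd
      induction h with
      | refl => exact ⟨0, by simp⟩
      | tail _ hs ih =>
        obtain ⟨n, hn⟩ := ih
        exact ⟨n + 1, pow_succ_pos' hN n hn (hs.pos hN)⟩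
    obtain ⟨n, hn⟩ := key
    exact ⟨n + 1, n.succ_pos, pow_succ_pos' hN n hn ((MStep.self hkN hN y).pos hN)⟩
  · intro x
    refine ⟨0, fun n _ => ?_⟩
    induction n with
    | zero => simp
    | succ n ih => exact pow_succ_pos' hN n (ih (Nat.zero_le _)) ((MStep.self hkN hN x).pos hN)
end

section
/- The chain Q is lumpable with respect to configurations: if x, x' ∈ I^k have the same configuration {x} = {x'}, then for every configuration c, Σ_{y : {y} = c} Q(x,y) = Σ_{y : {y} = c} Q(x',y). -/
open Finset

theorem exists_perm_of_card {α β : Type*} [Fintype α] [DecidableEq β] (f g : α → β)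
    (h : ∀ c, (Finset.univ.filter fun a => f a = c).card
      = (Finset.univ.filter fun a => g a = c).card) :
    ∃ σ : Equiv.Perm α, ∀ a, g (σ a) = f a := by
  classical
  have e : ∀ c, Nonempty ({a // f a = c} ≃ {a // g a = c}) := fun c => by
    apply Fintype.card_eq.1
    rw [Fintype.card_subtype, Fintype.card_subtype, h c]
  exact ⟨Equiv.ofFiberEquiv fun c => (e c).some, fun a => Equiv.ofFiberEquiv_map _ a⟩

def mult {N k : ℕ} (x : Fin k → Fin N) (v : Fin N) : ℕ :=
  (Finset.univ.filter fun m => x m = v).card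

theorem mult_eq_zero {N k : ℕ} (x : Fin k → Fin N) (v : Fin N) :
    mult x v = 0 ↔ v ∉ Finset.image x Finset.univ := by
  simp [mult, Finset.filter_eq_empty_iff]

theorem count_config {N k : ℕ} (x : Fin k → Fin N) (c : ℕ) (hc : c ≠ 0) :
    (Finset.univ.filter fun v => mult x v = c).card = (config x).count c := by
  unfold config
  rw [Multiset.count_map, ← Finset.filter_val, Finset.card_val]
  congr 1
  ext v
  have := mult_eq_zero x v
  simp only [Finset.mem_filter, Finset.mem_univ, true_and]
  change _ ↔ _ ∧ c = mult x v
  grind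

theorem zero_config {N k : ℕ} (x : Fin k → Fin N) :
    (Finset.univ.filter fun v => mult x v = 0).card = N - (config x).card := by
  unfold config
  rw [Multiset.card_map, Finset.card_val]
  simp only [mult_eq_zero]
  rw [← Finset.compl_filter, Finset.card_compl, Fintype.card_fin]
  simp

theorem exists_perms {N k : ℕ} (x x' : Fin k → Fin N) (h : config x = config x') :
    ∃ (σ : Equiv.Perm (Fin N)) (τ : Equiv.Perm (Fin k)), ∀ m, x' (τ m) = σ (x m) := by
  obtain ⟨σ, hσ⟩ := exists_perm_of_card (mult x) (mult x') (fun c => by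
    by_cases hc : c = 0
    · subst hc; rw [zero_config, zero_config, h]
    · rw [count_config x c hc, count_config x' c hc, h])
  obtain ⟨τ, hτ⟩ := exists_perm_of_card (fun m => σ (x m)) x' (fun c => by
    have := hσ (σ.symm c)
    rw [Equiv.apply_symm_apply] at this
    unfold mult at this
    rw [this]
    congr 1
    ext m
    simp [Equiv.eq_symm_apply])
  exact ⟨σ, τ, hτ⟩

/-- The induced bijection on states. -/
def act {N k : ℕ} (σ : Equiv.Perm (Fin N)) (τ : Equiv.Perm (Fin k)) :
    (Fin k → Fin N) ≃ (Fin k → Fin N) := Equiv.arrowCongr τ σ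

theorem act_apply {N k : ℕ} (σ : Equiv.Perm (Fin N)) (τ : Equiv.Perm (Fin k))
    (y : Fin k → Fin N) (m : Fin k) : act σ τ y (τ m) = σ (y m) := by
  simp [act, Equiv.arrowCongr]

theorem config_act {N k : ℕ} (σ : Equiv.Perm (Fin N)) (τ : Equiv.Perm (Fin k))
    (y : Fin k → Fin N) : config (act σ τ y) = config y := by
  have hi : Finset.image (act σ τ y) Finset.univ
      = (Finset.image y Finset.univ).map σ.toEmbedding := by
    ext v
    simp only [Finset.mem_image, Finset.mem_map, Finset.mem_univ, true_and]
    constructor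
    · rintro ⟨m, rfl⟩
      refine ⟨y (τ.symm m), ⟨_, rfl⟩, ?_⟩
      have := act_apply σ τ y (τ.symm m)
      simpa using this.symm
    · rintro ⟨_, ⟨m, rfl⟩, rfl⟩
      exact ⟨τ m, act_apply σ τ y m⟩
  unfold config
  rw [hi, Finset.map_val, Multiset.map_map]
  apply Multiset.map_congr rfl
  intro v _
  symm
  refine Finset.card_bij (fun m _ => τ m) ?_ ?_ ?_
  · intro m hm
    simp only [Finset.mem_filter, Finset.mem_univ, true_and] at hm ⊢
    rw [act_apply, hm]; rfl
  · intro a _ b _ hab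
    exact τ.injective hab
  · intro m hm
    obtain ⟨m, rfl⟩ := τ.surjective m
    simp only [Finset.mem_filter, Finset.mem_univ, true_and] at hm
    rw [act_apply] at hm
    exact ⟨m, by simpa using σ.injective hm, rfl⟩

theorem Qmat_act {N k : ℕ} (σ : Equiv.Perm (Fin N)) (τ : Equiv.Perm (Fin k))
    (x y : Fin k → Fin N) : Qmat N k (act σ τ x) (act σ τ y) = Qmat N k x y := by
  unfold Qmat
  congr 1
  symm
  refine Finset.sum_equiv (Equiv.prodCongr σ (Equiv.prodCongr σ σ)) ?_ ?_
  · intro p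
    simp [distinctTriplesFinset]
  · intro p _
    refine Fintype.prod_equiv τ _ _ ?_
    intro m
    simp [qFactor, act_apply]

/-- Lumpability of `Q` with respect to configurations: if `x` and `x'` have the same
configuration, then for every configuration `c` the total transition probabilities from `x`
and from `x'` into the set of states with configuration `c` coincide. -/
theorem Qmat_lumpable (N k : ℕ) (hk : 1 ≤ k) (hkN : k < N) (hN : 3 ≤ N)
    (x x' : Fin k → Fin N) (hxx' : config x = config x') :
    ∀ c : Multiset ℕ,
      ∑ y ∈ Finset.univ.filter (fun y : Fin k → Fin N => config y = c), Qmat N k x y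
        = ∑ y ∈ Finset.univ.filter (fun y : Fin k → Fin N => config y = c), Qmat N k x' y := by
  intro c
  obtain ⟨σ, τ, h⟩ := exists_perms x x' hxx'
  have hx : x' = act σ τ x := by
    funext m
    obtain ⟨m, rfl⟩ := τ.surjective m
    rw [h, act_apply]
  refine Finset.sum_equiv (act σ τ) ?_ ?_
  · intro y
    simp [config_act]
  · intro y _
    rw [hx, Qmat_act]
end

section
/- Fix k ≥ 2. For each N > k and every x ∈ I^k with pairwise distinct coordinates, the probability that the chain Q started at x has pairwise distinct coordinates after one step satisfies Σ_{y injective} Q(x,y) = 1 − k(k−1)/N² + O(1/N³) as N → ∞; i.e. there is a constant C (depending only on k) with | Σ_{y injective} Q(x,y) − (1 − k(k−1)/N²) | ≤ C/N³ for all N > k and all injective x. -/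
open Finset

lemma aux_prod {N k : ℕ} (x y : Fin k → Fin N) (hx : Function.Injective x)
    (p : Fin N × Fin N × Fin N) :
    ∏ m : Fin k, qFactor x y p m =
      (if y = (fun m => if x m = p.2.2 then p.1 else x m) then (1/2 : ℝ) else 0) +
      (if y = (fun m => if x m = p.2.2 then p.2.1 else x m) then (1/2 : ℝ) else 0) := by
  by_cases h : ∃ m0, x m0 = p.2.2
  · obtain ⟨m0, hm0⟩ := h
    have hne : ∀ m, x m = p.2.2 ↔ m = m0 := fun m =>
      ⟨fun h => hx (h.trans hm0.symm), fun h => h ▸ hm0⟩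
    have key : ∀ a : Fin N, (y = fun m => if x m = p.2.2 then a else x m) ↔
        (y m0 = a ∧ ∀ m ∈ univ.erase m0, y m = x m) := by
      intro a
      simp only [funext_iff, hne, mem_erase, mem_univ, and_true]
      constructor
      · intro h
        refine ⟨by simpa using h m0, fun m hm => by simpa [hm] using h m⟩
      · rintro ⟨h1, h2⟩ m
        by_cases hm : m = m0
        · subst hm; simpa using h1
        · simpa [hm] using h2 m hm
    rw [← Finset.mul_prod_erase univ _ (mem_univ m0)]
    have : ∏ m ∈ univ.erase m0, qFactor x y p m =
        if ∀ m ∈ univ.erase m0, y m = x m then (1:ℝ) else 0 := by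
      have : ∀ m ∈ univ.erase m0, qFactor x y p m = if y m = x m then 1 else 0 := by
        intro m hm
        have : ¬ x m = p.2.2 := by rw [hne]; exact (mem_erase.1 hm).1
        simp [qFactor, this]
      rw [Finset.prod_congr rfl this, Finset.prod_ite_zero]
      simp
    rw [this]
    simp only [key, qFactor, hm0, if_true]
    by_cases hh : ∀ m ∈ univ.erase m0, y m = x m
    · rw [if_pos hh, mul_one]
      simp only [and_iff_left hh]
    · rw [if_neg hh, mul_zero, if_neg fun h => hh h.2, if_neg fun h => hh h.2, add_zero]
  · push Not at h
    have h1 : ∀ a, (fun m => if x m = p.2.2 then a else x m) = x := by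
      intro a; funext m; simp [h m]
    have h2 : ∀ m, qFactor x y p m = if y m = x m then 1 else 0 := by
      intro m; simp [qFactor, h m]
    have h3 : (∀ m ∈ (univ : Finset (Fin k)), y m = x m) ↔ y = x := by
      simp [funext_iff]
    simp only [h1, h2, Finset.prod_ite_zero, prod_const_one, h3]
    split_ifs <;> norm_num

lemma aux_inj {N k : ℕ} (x : Fin k → Fin N) (hx : Function.Injective x) (a c : Fin N)
    (hac : a ≠ c) :
    Function.Injective (fun m => if x m = c then a else x m) ↔
      ¬ (a ∈ univ.image x ∧ c ∈ univ.image x) := by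
  simp only [mem_image, mem_univ, true_and]
  constructor
  · rintro h ⟨⟨i, rfl⟩, ⟨j, rfl⟩⟩
    have : i = j := h (by simp [hac])
    exact hac (this ▸ rfl)
  · intro h i j hij
    simp only at hij
    split_ifs at hij with h1 h2 h2
    · exact hx (h1.trans h2.symm)
    · exact absurd ⟨⟨j, hij.symm⟩, ⟨i, h1⟩⟩ h
    · exact absurd ⟨⟨i, hij⟩, ⟨j, h2⟩⟩ h
    · exact hx hij

lemma aux_card {N : ℕ} (hN : 2 ≤ N) (a c : Fin N) (hac : a ≠ c) (r : ℝ) :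
    (∑ b : Fin N, if a ≠ b ∧ b ≠ c then r else 0) = ((N : ℝ) - 2) * r := by
  rw [← Finset.sum_filter, Finset.sum_const, nsmul_eq_mul]
  have : (univ.filter fun b : Fin N => a ≠ b ∧ b ≠ c) = univ \ {a, c} := by
    ext b; simp [eq_comm]
  rw [this, Finset.card_sdiff_of_subset (subset_univ _), Finset.card_pair hac, card_univ,
    Fintype.card_fin, Nat.cast_sub hN]
  norm_num

lemma aux_sum1 {N : ℕ} (hN : 2 ≤ N) (g : Fin N → Fin N → ℝ) :
    ∑ p ∈ distinctTriplesFinset N, g p.1 p.2.2 =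
      ((N : ℝ) - 2) * ∑ q ∈ (univ : Finset (Fin N)).offDiag, g q.1 q.2 := by
  have e : (univ : Finset (Fin N)).offDiag = univ.filter fun q => q.1 ≠ q.2 := by
    ext q; simp
  rw [e, distinctTriplesFinset, sum_filter, sum_filter]
  simp only [Fintype.sum_prod_type]
  rw [mul_sum]
  refine sum_congr rfl fun a _ => ?_
  rw [sum_comm, mul_sum]
  refine sum_congr rfl fun c _ => ?_
  by_cases hac : a = c
  · simp [hac]
  · simp only [ne_eq, hac, not_false_eq_true, true_and, if_true]
    exact aux_card hN a c hac _

lemma aux_sum2 {N : ℕ} (hN : 2 ≤ N) (g : Fin N → Fin N → ℝ) :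
    ∑ p ∈ distinctTriplesFinset N, g p.2.1 p.2.2 =
      ((N : ℝ) - 2) * ∑ q ∈ (univ : Finset (Fin N)).offDiag, g q.1 q.2 := by
  rw [← aux_sum1 hN]
  refine sum_nbij' (fun p => (p.2.1, p.1, p.2.2)) (fun p => (p.2.1, p.1, p.2.2)) ?_ ?_ ?_ ?_ ?_ <;>
    simp [distinctTriplesFinset] <;> grind

lemma aux_g {N k : ℕ} (x : Fin k → Fin N) (hx : Function.Injective x) :
    ∑ q ∈ (univ : Finset (Fin N)).offDiag,
      (if Function.Injective (fun m => if x m = q.2 then q.1 else x m) then (1/2:ℝ) else 0) =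
      ((N:ℝ) * (N - 1) - k * (k - 1)) / 2 := by
  have h1 : ∀ q ∈ (univ : Finset (Fin N)).offDiag,
      (if Function.Injective (fun m => if x m = q.2 then q.1 else x m) then (1/2:ℝ) else 0) =
      1/2 - if q ∈ (univ.image x).offDiag then (1/2:ℝ) else 0 := by
    intro q hq
    have hne : q.1 ≠ q.2 := (mem_offDiag.1 hq).2.2
    simp only [aux_inj x hx _ _ hne, mem_offDiag, hne, ne_eq, not_false_eq_true, and_true]
    split_ifs <;> norm_num at * <;> tauto
  rw [sum_congr rfl h1, sum_sub_distrib, ← sum_filter]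
  have h2 : ((univ : Finset (Fin N)).offDiag.filter fun q => q ∈ (univ.image x).offDiag)
      = (univ.image x).offDiag := by
    ext q; simp
  rw [h2, sum_const, sum_const, offDiag_card, offDiag_card, card_image_of_injective _ hx]
  simp only [card_univ, Fintype.card_fin, nsmul_eq_mul]
  rw [Nat.cast_sub (Nat.le_mul_self _), Nat.cast_sub (Nat.le_mul_self _)]
  push_cast
  ring

lemma aux_exact {N k : ℕ} (hN : 3 ≤ N) (x : Fin k → Fin N) (hx : Function.Injective x) :
    (∑ y ∈ Finset.univ.filter (fun y : Fin k → Fin N => Function.Injective y), Qmat N k x y)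
      = 1 - (k:ℝ) * (k - 1) / (N * (N - 1)) := by
  have hN' : (3:ℝ) ≤ N := by exact_mod_cast hN
  unfold Qmat
  rw [← mul_sum, sum_comm]
  simp only [aux_prod x _ hx, sum_add_distrib, sum_ite_eq', mem_filter, mem_univ, true_and]
  rw [aux_sum1 (by omega) (fun a c => if Function.Injective (fun m => if x m = c then a else x m)
      then (1/2:ℝ) else 0),
    aux_sum2 (by omega) (fun a c => if Function.Injective (fun m => if x m = c then a else x m)
      then (1/2:ℝ) else 0), aux_g x hx]
  have h0 : (N:ℝ) ≠ 0 := by linarith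
  have h1 : (N:ℝ) - 1 ≠ 0 := by linarith
  have h2 : (N:ℝ) - 2 ≠ 0 := by linarith
  field_simp
  ring

/-- For an injective state `x ∈ I^k`, the probability that the chain `Q` started at `x` is
still injective after one step is `1 - k(k-1)/N² + O(1/N³)`, uniformly in `x`. -/
theorem Qmat_stay_injective_asymptotics (k : ℕ) (hk : 2 ≤ k) :
    ∃ C : ℝ, ∀ N : ℕ, k < N → ∀ x : Fin k → Fin N, Function.Injective x →
      |(∑ y ∈ Finset.univ.filter (fun y : Fin k → Fin N => Function.Injective y),
          Qmat N k x y)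
        - (1 - (k : ℝ) * ((k : ℝ) - 1) / (N : ℝ) ^ 2)| ≤ C / (N : ℝ) ^ 3 := by
  refine ⟨2 * (k * (k - 1)), fun N hN x hx => ?_⟩
  rw [aux_exact (by omega) x hx]
  have hN' : (3:ℝ) ≤ N := by exact_mod_cast (by omega : 3 ≤ N)
  have hk' : (2:ℝ) ≤ k := by exact_mod_cast hk
  have h0 : (0:ℝ) < N := by linarith
  have h1 : (0:ℝ) < (N:ℝ) - 1 := by linarith
  have hK : (0:ℝ) ≤ (k:ℝ) * (k - 1) := mul_nonneg (by linarith) (by linarith)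
  generalize (k:ℝ) * (k - 1) = K at *
  have e : 1 - K / ((N:ℝ) * (N - 1)) - (1 - K / (N:ℝ) ^ 2) = -(K / ((N:ℝ) ^ 2 * (N - 1))) := by
    field_simp
    ring
  rw [e, abs_neg, abs_of_nonneg (by positivity), div_le_div_iff₀ (by positivity) (by positivity)]
  have : 0 ≤ K * (N:ℝ) ^ 2 * (N - 2) :=
    mul_nonneg (by positivity) (by linarith)
  nlinarith
end

section
/- Define K on finite multisets of positive integers by K({k_1,...,k_l}) = ∏_{i=1}^{l} 2^{k_i − 1} · k_i!. Then for every multiset {k_1,...,k_l} of positive integers, K({k_1,...,k_l}) · ( l − 2 Σ_{μ=1}^{l} (1/2)^{k_μ} ) = 2 Σ_{μ=1}^{l} Σ_{i=1}^{k_μ − 1} (1/2)^{i} · binom(k_μ, i) · K({k_1,...,k_{μ−1}, k_μ − i, k_{μ+1},...,k_l, i}), where the multiset on the right is obtained from {k_1,...,k_l} by replacing the element k_μ with the two elements k_μ − i and i. -/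
open Finset

/-- The function `K({k_1, ..., k_l}) = ∏ i, 2^(k_i - 1) · k_i!` on finite multisets of
positive integers. -/
noncomputable def Kfun (m : Multiset ℕ) : ℝ :=
  (m.map fun a => (2 : ℝ) ^ (a - 1) * a.factorial).prod

theorem Kfun_half_geom (a : ℕ) (ha : 0 < a) :
    ∑ i ∈ Finset.Ico 1 a, ((1 : ℝ) / 2) ^ i = 1 - 2 * ((1 : ℝ) / 2) ^ a := by
  induction a, ha using Nat.le_induction with
  | base => norm_num
  | succ n hn ih =>
    rw [Finset.sum_Ico_succ_top hn, ih]
    ring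

theorem Kfun_split (m : Multiset ℕ) (a i : ℕ) (ha : a ∈ m) (h1 : 1 ≤ i) (h2 : i < a) :
    2 * ((a.choose i : ℝ) * Kfun (i ::ₘ (a - i) ::ₘ m.erase a)) = Kfun m := by
  conv_rhs => rw [← Multiset.cons_erase ha]
  unfold Kfun
  simp only [Multiset.map_cons, Multiset.prod_cons]
  have h : ((a.choose i : ℝ) * i.factorial * (a - i).factorial) = a.factorial := by
    exact_mod_cast Nat.choose_mul_factorial_mul_factorial h2.le
  have hp : (2 : ℝ) ^ (a - 1) = 2 * (2 ^ (i - 1) * 2 ^ (a - i - 1)) := by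
    rw [← pow_add, ← pow_succ']
    congr 1
    omega
  rw [← h, hp]
  ring

/-- The function `K({k_1,...,k_l}) = ∏ i, 2^(k_i-1)·k_i!` satisfies, on every multiset of
positive integers, the recursion
`K({k_1,...,k_l}) · (l - 2 Σ_μ (1/2)^{k_μ})
  = 2 Σ_μ Σ_{i=1}^{k_μ - 1} (1/2)^i · binom(k_μ, i) · K({k_1,...,k_μ - i,...,k_l, i})`,
where the multiset on the right is obtained by replacing the element `k_μ` with the two
elements `k_μ - i` and `i`. -/
theorem Kfun_recursion (m : Multiset ℕ) (hm : ∀ a ∈ m, 0 < a) :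
    Kfun m * ((m.card : ℝ) - 2 * (m.map fun a => ((1 : ℝ) / 2) ^ a).sum)
      = 2 * (m.map fun a => ∑ i ∈ Finset.Ico 1 a,
          ((1 : ℝ) / 2) ^ i * (a.choose i) * Kfun (i ::ₘ (a - i) ::ₘ m.erase a)).sum := by
  have key : ∀ a ∈ m, (∑ i ∈ Finset.Ico 1 a,
      ((1 : ℝ) / 2) ^ i * (a.choose i) * Kfun (i ::ₘ (a - i) ::ₘ m.erase a))
      = Kfun m / 2 * (1 - 2 * ((1 : ℝ) / 2) ^ a) := by
    intro a ha
    rw [← Kfun_half_geom a (hm a ha), Finset.mul_sum]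
    refine Finset.sum_congr rfl fun i hi => ?_
    rw [Finset.mem_Ico] at hi
    rw [← Kfun_split m a i ha hi.1 hi.2]
    ring
  rw [Multiset.map_congr rfl key, Multiset.sum_map_mul_left, Multiset.sum_map_sub,
    Multiset.sum_map_mul_left]
  simp only [Multiset.map_const', Multiset.sum_replicate, nsmul_eq_mul, mul_one]
  ring
end
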